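/- Let x ∈ V(n,k), suppose l ∈ x and l < m ≤ n with x ∩ [l,m] = {l}, and for 1 ≤ j ≤ p := m − l + 1 set x^j = (x \ {l}) ∪ {l + j − 1} (so x^1 = x and x^p = (x \ {l}) ∪ {m}). Then for every 1 ≤ q ≤ p and every 1 ≤ i ≤ n, the absolute values add exactly along the chain: |v|_i(x^1, x^q) = Σ_{r=1}^{q−1} |v|_i(x^r, x^{r+1}). -/

import Mathlib

/-- `x` is an I-state in `V(n,k)`: a subset of `{0,…,n}` with `k` elements. -/
def Istate (n k : ℕ) (x : Finset ℕ) : Prop :=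
  x ⊆ Finset.range (n + 1) ∧ x.card = k

/-- Minimal relative weight vector `v_i(x,y) = |y ∩ [i,n]| − |x ∩ [i,n]|`. -/
def vwt (n : ℕ) (x y : Finset ℕ) (i : ℕ) : ℤ :=
  ((y ∩ Finset.Icc i n).card : ℤ) - ((x ∩ Finset.Icc i n).card : ℤ)

/-- Minimal relative grading vector `|v|_i(x,y) = |v_i(x,y)|`. -/
def avwt (n : ℕ) (x y : Finset ℕ) (i : ℕ) : ℤ := |vwt n x y i|

/-- Inserting a new element `a ≤ n` raises the count in `[i,n]` by one exactly when `i ≤ a`. -/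
theorem card_insert_inter_Icc {y : Finset ℕ} {a n : ℕ} (i : ℕ) (ha : a ∉ y) (han : a ≤ n) :
    ((insert a y ∩ Finset.Icc i n).card : ℤ) =
      (y ∩ Finset.Icc i n).card + if i ≤ a then 1 else 0 := by
  split_ifs with h
  · rw [Finset.insert_inter_of_mem (Finset.mem_Icc.2 ⟨h, han⟩),
      Finset.card_insert_of_notMem (fun h' => ha (Finset.mem_inter.1 h').1)]
    push_cast
    rfl
  · rw [Finset.insert_inter_of_notMem (fun h' => h (Finset.mem_Icc.1 h').1), add_zero]

/-- For three elements `a ≤ b ≤ c` outside `y`, the grading vectors between the sets obtained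
from `y` by adjoining one of them are additive. -/
theorem avwt_insert_add {y : Finset ℕ} {a b c n : ℕ} (i : ℕ) (ha : a ∉ y) (hb : b ∉ y)
    (hc : c ∉ y) (hab : a ≤ b) (hbc : b ≤ c) (hcn : c ≤ n) :
    avwt n (insert a y) (insert c y) i =
      avwt n (insert a y) (insert b y) i + avwt n (insert b y) (insert c y) i := by
  simp only [avwt, vwt, card_insert_inter_Icc i ha (hab.trans (hbc.trans hcn)),
    card_insert_inter_Icc i hb (hbc.trans hcn), card_insert_inter_Icc i hc hcn,
    add_sub_add_left_eq_sub]
  split_ifs <;> first | omega | simp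

/-- Along the chain `x = x^1, x^2, …, x^p = (x \ {l}) ∪ {m}` obtained by moving the
dot at `l` one step at a time to `m`, the grading vectors `|v|_i` add exactly:
`|v|_i(x^1, x^q) = ∑_{r=1}^{q−1} |v|_i(x^r, x^{r+1})`. -/
theorem stmt3 (n k : ℕ) (hn : 1 ≤ n) (x : Finset ℕ) (hx : Istate n k x)
    (l m : ℕ) (hl : l ∈ x) (hlm : l < m) (hm : m ≤ n)
    (hcap : x ∩ Finset.Icc l m = {l})
    (X : ℕ → Finset ℕ) (hX : ∀ j, X j = insert (l + j - 1) (x.erase l))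
    (q : ℕ) (hq1 : 1 ≤ q) (hqp : q ≤ m - l + 1)
    (i : ℕ) (hi1 : 1 ≤ i) (hin : i ≤ n) :
    avwt n (X 1) (X q) i = ∑ r ∈ Finset.Ico 1 q, avwt n (X r) (X (r + 1)) i := by
  have hnot : ∀ j, 1 ≤ j → j ≤ m - l + 1 → l + j - 1 ∉ x.erase l := by
    intro j _ hj h
    obtain ⟨hne, hmem⟩ := Finset.mem_erase.1 h
    have : l + j - 1 ∈ x ∩ Finset.Icc l m :=
      Finset.mem_inter.2 ⟨hmem, Finset.mem_Icc.2 ⟨by omega, by omega⟩⟩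
    rw [hcap] at this
    exact hne (Finset.mem_singleton.1 this)
  induction q, hq1 using Nat.le_induction with
  | base => simp [avwt, vwt]
  | succ q hq ih =>
    rw [Finset.sum_Ico_succ_top hq, ← ih (by omega), hX 1, hX q, hX (q + 1)]
    exact avwt_insert_add i (hnot 1 le_rfl (by omega)) (hnot q hq (by omega))
      (hnot (q + 1) (by omega) hqp) (by omega) (by omega) (by omega)
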